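/- For ℙ-almost every ω ∈ Ω, the Hausdorff dimension of the uniformly random self-similar set F(ω) satisfies dim_H F(ω) ≤ min{s, d}. -/

import Mathlib

open MeasureTheory Filter Topology
open scoped ENNReal

noncomputable section

abbrev E (d : ℕ) : Type := EuclideanSpace ℝ (Fin d)

abbrev Od (d : ℕ) : Type := Matrix.orthogonalGroup (Fin d) ℝ

instance (d : ℕ) : MeasurableSpace (Od d) := borel _
instance (d : ℕ) : BorelSpace (Od d) := ⟨rfl⟩

/-- The action of an orthogonal matrix on Euclidean space, as a linear map. -/
def act (d : ℕ) (Q : Od d) : E d →ₗ[ℝ] E d :=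
  Matrix.toEuclideanLin (Q : Matrix (Fin d) (Fin d) ℝ)

/-- The set `J` of finite nonempty words: a word of length `k+1` is a function
`Fin (k+1) → Fin m`. -/
abbrev JW (m : ℕ) : Type := Σ k : ℕ, (Fin (k + 1) → Fin m)

noncomputable instance (m : ℕ) : DecidableEq (JW m) := fun _ _ => Classical.dec _

/-- The label space `(σ₋,σ₊) × O(d)`. -/
abbrev Label (d : ℕ) (σm σp : ℝ) : Type := ↥(Set.Ioo σm σp) × Od d

/-- The space `Ω` of labelled trees. -/
abbrev Omega (d m : ℕ) (σm σp : ℝ) : Type := JW m → Label d σm σp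

variable {d m : ℕ} {σm σp : ℝ}

/-- The similarity map `T_i^ω = r_i^ω • Q_i^ω` attached to the node `w`. -/
def Tnode (ω : Omega d m σm σp) (w : JW m) : E d →ₗ[ℝ] E d :=
  ((ω w).1 : ℝ) • act d (ω w).2

/-- The initial word `𝐢_{k+1}` (first `k+1` symbols) of an infinite word `i`. -/
def pre (i : ℕ → Fin m) (k : ℕ) : JW m := ⟨k, fun j => i j.1⟩

/-- `cumT ω i n = T_{𝐢_1} ∘ ⋯ ∘ T_{𝐢_n}`. -/
def cumT (ω : Omega d m σm σp) (i : ℕ → Fin m) : ℕ → (E d →ₗ[ℝ] E d)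
  | 0 => LinearMap.id
  | n + 1 => (cumT ω i n).comp (Tnode ω (pre i n))

/-- `cumR ω i n = 𝐫_{𝐢_n}^ω = r_{𝐢_1}^ω ⋯ r_{𝐢_n}^ω` (equal to 1 if `n = 0`). -/
def cumR (ω : Omega d m σm σp) (i : ℕ → Fin m) (n : ℕ) : ℝ :=
  ∏ k ∈ Finset.range n, ((ω (pre i k)).1 : ℝ)

/-- `𝐫_w^ω` for a finite word `w`. -/
def wordR (ω : Omega d m σm σp) {k : ℕ} (w : Fin k → Fin m) : ℝ :=
  ∏ j : Fin k, ((ω ⟨j.1, fun t => w (Fin.castLE j.2 t)⟩).1 : ℝ)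

/-- The `k`-th partial sum `a_{i_1} + T_{𝐢_1}(a_{i_2}) + ⋯ + T_{𝐢_1}∘⋯∘T_{𝐢_k}(a_{i_{k+1}})`. -/
def partialSum (a : Fin m → E d) (ω : Omega d m σm σp) (i : ℕ → Fin m) (k : ℕ) : E d :=
  ∑ n ∈ Finset.range (k + 1), cumT ω i n (a (i n))

/-- The point `π(i, ω)`. -/
def piMap (a : Fin m → E d) (ω : Omega d m σm σp) (i : ℕ → Fin m) : E d :=
  ∑' n : ℕ, cumT ω i n (a (i n))

/-- `cumTFrom ω i p q = T_{𝐢_{p+2}} ∘ ⋯ ∘ T_{𝐢_{p+1+q}}`. -/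
def cumTFrom (ω : Omega d m σm σp) (i : ℕ → Fin m) (p : ℕ) : ℕ → (E d →ₗ[ℝ] E d)
  | 0 => LinearMap.id
  | q + 1 => (cumTFrom ω i p q).comp (Tnode ω (pre i (p + 1 + q)))

/-- The random vector `x(i, ω, p)`. -/
def xMap (a : Fin m → E d) (ω : Omega d m σm σp) (i : ℕ → Fin m) (p : ℕ) : E d :=
  ∑' q : ℕ, cumTFrom ω i p q (a (i (p + 1 + q)))

/-- The uniform probability measure on `(σ₋, σ₊)`, as a measure on `ℝ`. -/
def unif (σm σp : ℝ) : Measure ℝ :=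
  (ENNReal.ofReal (σp - σm))⁻¹ • (volume.restrict (Set.Ioo σm σp))

/-- The uniform probability measure on `(σ₋, σ₊)`, as a measure on the subtype. -/
def unifSub (σm σp : ℝ) : Measure ↥(Set.Ioo σm σp) :=
  (ENNReal.ofReal (σp - σm))⁻¹ • ((volume : Measure ℝ).comap Subtype.val)

/-- The measure `λ × θ` on the label space. -/
def labelM (σm σp : ℝ) {d : ℕ} (θ : Measure (Od d)) : Measure (Label d σm σp) :=
  (unifSub σm σp).prod θ

/-- The cylinder `[w]` of a finite word `w`. -/
def cyl {m k : ℕ} (w : Fin k → Fin m) : Set (ℕ → Fin m) := {j | ∀ t : Fin k, j t.1 = w t}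

/-- The cylinder `[w]` of a node `w : JW m`. -/
def cylNode {m : ℕ} (w : JW m) : Set (ℕ → Fin m) := {j | ∀ t : Fin (w.1 + 1), j t.1 = w.2 t}

/-- The σ-algebra `𝓕_k` generated by the labels at nodes of length at most `k`. -/
def Fk (d m : ℕ) (σm σp : ℝ) (k : ℕ) : MeasurableSpace (Omega d m σm σp) :=
  ⨆ w : {w : JW m // w.1 + 1 ≤ k}, MeasurableSpace.comap (fun ω => ω w.1) inferInstance

/-- `P` is the product measure `(λ×θ)^J`: coordinates are independent with law `λ×θ`. -/
def IsProductLaw (θ : Measure (Od d)) (P : Measure (Omega d m σm σp)) : Prop :=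
  ∀ (S : Finset (JW m)) (A : JW m → Set (Label d σm σp)),
    (∀ w, MeasurableSet (A w)) →
    P {ω | ∀ w ∈ S, ω w ∈ A w} = ∏ w ∈ S, labelM σm σp θ (A w)

/-- The uniformly random self-similar set `F(ω)`. -/
def Fset (a : Fin m → E d) (ω : Omega d m σm σp) : Set (E d) := Set.range (piMap a ω)

/-- `w` is an initial subword of `v`. -/
def isPrefix {m : ℕ} (w v : JW m) : Prop :=
  ∃ h : w.1 ≤ v.1, ∀ t : Fin (w.1 + 1), v.2 (Fin.castLE (Nat.succ_le_succ h) t) = w.2 t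

end

open ProbabilityTheory

lemma act_norm (d : ℕ) (Q : Od d) (x : E d) : ‖act d Q x‖ = ‖x‖ := by
  have h : (Matrix.transpose (Q : Matrix (Fin d) (Fin d) ℝ)) * (Q : Matrix (Fin d) (Fin d) ℝ) = 1 :=
    (Matrix.mem_orthogonalGroup_iff' (Fin d) ℝ).1 Q.2
  have h2 : ‖act d Q x‖ ^ 2 = ‖x‖ ^ 2 := by
    rw [EuclideanSpace.real_norm_sq_eq, EuclideanSpace.real_norm_sq_eq]
    have e : ∀ y : Fin d → ℝ, ∑ i, y i ^ 2 = dotProduct y y := by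
      intro y; simp [dotProduct, sq]
    have e1 : ∀ i, (act d Q x) i = (Matrix.mulVec (Q : Matrix (Fin d) (Fin d) ℝ) x.ofLp) i := by
      intro i; rfl
    simp only [e1]
    rw [e, e, Matrix.dotProduct_mulVec, Matrix.vecMul_mulVec, h]
    simp
  exact (sq_eq_sq₀ (norm_nonneg _) (norm_nonneg _)).1 h2

lemma cumT_norm {d m : ℕ} {σm σp : ℝ} (hσ0 : 0 < σm) (ω : Omega d m σm σp) (i : ℕ → Fin m) (n : ℕ) :
    ∀ x, ‖cumT ω i n x‖ = cumR ω i n * ‖x‖ := by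
  induction n with
  | zero => intro x; simp [cumT, cumR]
  | succ n ih =>
    intro x
    have hp : 0 < ((ω (pre i n)).1 : ℝ) := hσ0.trans (ω (pre i n)).1.2.1
    simp only [cumT, LinearMap.comp_apply, ih, Tnode, LinearMap.smul_apply, norm_smul, act_norm,
      cumR, Finset.prod_range_succ, Real.norm_eq_abs, abs_of_pos hp]
    ring

lemma cumR_nonneg {d m : ℕ} {σm σp : ℝ} (hσ0 : 0 < σm) (ω : Omega d m σm σp) (i : ℕ → Fin m)
    (n : ℕ) : 0 ≤ cumR ω i n :=
  Finset.prod_nonneg fun k _ => (hσ0.trans (ω (pre i k)).1.2.1).le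

lemma cumR_le {d m : ℕ} {σm σp : ℝ} (hσ0 : 0 < σm) (ω : Omega d m σm σp) (i : ℕ → Fin m)
    (n k : ℕ) : cumR ω i (k + n) ≤ cumR ω i n * σp ^ k := by
  induction k with
  | zero => simp
  | succ k ih =>
    have e : k + 1 + n = (k + n) + 1 := by ring
    have hq := (ω (pre i (k + n))).1.2
    rw [e, cumR, Finset.prod_range_succ, pow_succ, ← mul_assoc]
    exact mul_le_mul ih hq.2.le (hσ0.trans hq.1).le (ih.trans' (cumR_nonneg hσ0 ω i _))

lemma cumT_congr {d m : ℕ} {σm σp : ℝ} (ω : Omega d m σm σp) (i j : ℕ → Fin m) (n : ℕ)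
    (h : ∀ t < n, i t = j t) : cumT ω i n = cumT ω j n := by
  induction n with
  | zero => rfl
  | succ n ih =>
    have e : pre i n = pre j n := by
      unfold pre; congr 1; funext t; exact h t.1 t.2
    simp only [cumT, e, ih (fun t ht => h t (by omega))]

lemma piMap_tail {d m : ℕ} {σm σp : ℝ} (hσ0 : 0 < σm) (hσ1 : σm ≤ σp) (hσ2 : σp < 1)
    (a : Fin m → E d) (M : ℝ) (hM : ∀ t, ‖a t‖ ≤ M) (ω : Omega d m σm σp) (i : ℕ → Fin m) (n : ℕ) :
    ‖piMap a ω i - ∑ k ∈ Finset.range n, cumT ω i k (a (i k))‖ ≤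
      M * (1 - σp)⁻¹ * cumR ω i n := by
  have hb : ∀ n k, ‖cumT ω i (k + n) (a (i (k + n)))‖ ≤ cumR ω i n * M * σp ^ k := by
    intro n k
    rw [cumT_norm hσ0]
    have h0 := cumR_nonneg hσ0 ω i (k + n)
    have h1 := cumR_le hσ0 ω i n k
    have h2 := hM (i (k+n))
    calc cumR ω i (k + n) * ‖a (i (k + n))‖ ≤ (cumR ω i n * σp ^ k) * M :=
          mul_le_mul h1 h2 (norm_nonneg _) (h0.trans h1)
      _ = _ := by ring
  have hg := hasSum_geometric_of_lt_one (hσ0.le.trans hσ1) hσ2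
  have hsum : Summable fun k => cumT ω i k (a (i k)) :=
    Summable.of_norm_bounded (hg.summable.mul_left (cumR ω i 0 * M)) (fun k => hb 0 k)
  rw [piMap, ← hsum.sum_add_tsum_nat_add n, add_sub_cancel_left]
  refine (tsum_of_norm_bounded (hg.mul_left (cumR ω i n * M)) (hb n)).trans (le_of_eq (by ring))

lemma cumR_eq_wordR {d m : ℕ} {σm σp : ℝ} (ω : Omega d m σm σp) {n : ℕ} (w : Fin n → Fin m)
    (i : ℕ → Fin m) (hi : i ∈ cyl w) : cumR ω i n = wordR ω w := by
  rw [cumR, wordR, Finset.prod_range]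
  refine Finset.prod_congr rfl fun j _ => ?_
  have : pre i j.1 = ⟨j.1, fun t => w (Fin.castLE j.2 t)⟩ := by
    unfold pre; congr 1; funext t; exact hi (Fin.castLE j.2 t)
  rw [this]

lemma ediam_cyl {d m : ℕ} {σm σp : ℝ} (hσ0 : 0 < σm) (hσ1 : σm ≤ σp) (hσ2 : σp < 1)
    (a : Fin m → E d) (M : ℝ) (hM : ∀ t, ‖a t‖ ≤ M) (ω : Omega d m σm σp) {n : ℕ}
    (w : Fin n → Fin m) :
    Metric.ediam (piMap a ω '' cyl w) ≤ ENNReal.ofReal (2 * (M * (1 - σp)⁻¹) * wordR ω w) := by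
  apply Metric.ediam_le_of_forall_dist_le
  rintro _ ⟨i, hi, rfl⟩ _ ⟨j, hj, rfl⟩
  have h1 := piMap_tail hσ0 hσ1 hσ2 a M hM ω i n
  have h2 := piMap_tail hσ0 hσ1 hσ2 a M hM ω j n
  have hij : ∀ t < n, i t = j t := fun t ht => (hi ⟨t, ht⟩).trans (hj ⟨t, ht⟩).symm
  have e : ∑ k ∈ Finset.range n, cumT ω i k (a (i k)) = ∑ k ∈ Finset.range n, cumT ω j k (a (j k)) := by
    refine Finset.sum_congr rfl fun k hk => ?_
    rw [Finset.mem_range] at hk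
    rw [cumT_congr ω i j k (fun t ht => hij t (by omega)), hij k hk]
  rw [cumR_eq_wordR ω w i hi, e] at h1
  rw [cumR_eq_wordR ω w j hj] at h2
  rw [← dist_eq_norm] at h1 h2
  have := dist_triangle_right (piMap a ω i) (piMap a ω j) (∑ k ∈ Finset.range n, cumT ω j k (a (j k)))
  linarith

lemma wordR_nonneg {d m : ℕ} {σm σp : ℝ} (hσ0 : 0 < σm) (ω : Omega d m σm σp) {n : ℕ}
    (w : Fin n → Fin m) : 0 ≤ wordR ω w :=
  Finset.prod_nonneg fun k _ => (hσ0.trans (ω _).1.2.1).le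

lemma wordR_le {d m : ℕ} {σm σp : ℝ} (hσ0 : 0 < σm) (ω : Omega d m σm σp) {n : ℕ}
    (w : Fin n → Fin m) : wordR ω w ≤ σp ^ n := by
  calc wordR ω w ≤ ∏ j : Fin n, σp :=
        Finset.prod_le_prod (fun j _ => (hσ0.trans (ω _).1.2.1).le) (fun j _ => (ω _).1.2.2.le)
    _ = _ := by simp

/-- deterministic bound -/
lemma det_bound {d m : ℕ} {σm σp : ℝ} (hσ0 : 0 < σm) (hσ1 : σm ≤ σp) (hσ2 : σp < 1)
    (a : Fin m → E d) (s : ℝ) (hs0 : 0 < s) : ∃ C : ℝ, 0 ≤ C ∧ ∀ ω : Omega d m σm σp,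
    μH[s] (Fset a ω) ≤ liminf (fun n : ℕ => ∑ w : Fin n → Fin m,
      ENNReal.ofReal C ^ s * ∏ j : Fin n,
        ENNReal.ofReal (((ω ⟨j.1, fun t => w (Fin.castLE j.2 t)⟩).1 : ℝ) ^ s)) atTop := by
  obtain ⟨M, hM0, hM⟩ : ∃ M : ℝ, 0 ≤ M ∧ ∀ t, ‖a t‖ ≤ M :=
    ⟨∑ t, ‖a t‖, by positivity, fun t =>
      Finset.single_le_sum (f := fun t => ‖a t‖) (fun _ _ => norm_nonneg _) (Finset.mem_univ t)⟩
  have hC : 0 ≤ 2 * (M * (1 - σp)⁻¹) := by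
    have : 0 < 1 - σp := by linarith
    positivity
  refine ⟨2 * (M * (1 - σp)⁻¹), hC, fun ω => ?_⟩
  set C := 2 * (M * (1 - σp)⁻¹)
  refine (Measure.hausdorffMeasure_le_liminf_sum s (Fset a ω) (l := atTop)
    (ι := fun n : ℕ => (Fin n → Fin m))
    (fun n : ℕ => ENNReal.ofReal (C * σp ^ n)) ?_ (fun n w => piMap a ω '' cyl w) ?_ ?_).trans ?_
  · have : Tendsto (fun n : ℕ => C * σp ^ n) atTop (𝓝 (C * 0)) :=
      (tendsto_pow_atTop_nhds_zero_of_lt_one (hσ0.le.trans hσ1) hσ2).const_mul C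
    simpa using ENNReal.tendsto_ofReal this
  · refine Eventually.of_forall fun n w => ?_
    exact (ediam_cyl hσ0 hσ1 hσ2 a M hM ω w).trans
      (ENNReal.ofReal_le_ofReal (mul_le_mul_of_nonneg_left (wordR_le hσ0 ω w) hC))
  · refine Eventually.of_forall fun n => ?_
    rintro _ ⟨i, rfl⟩
    exact Set.mem_iUnion.2 ⟨fun t => i t.1, i, fun t => rfl, rfl⟩
  · refine liminf_le_liminf (Eventually.of_forall fun n => Finset.sum_le_sum fun w _ => ?_)
    refine (ENNReal.rpow_le_rpow (ediam_cyl hσ0 hσ1 hσ2 a M hM ω w) hs0.le).trans (le_of_eq ?_)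
    rw [ENNReal.ofReal_mul hC, ENNReal.mul_rpow_of_nonneg _ _ hs0.le,
      ENNReal.ofReal_rpow_of_nonneg (wordR_nonneg hσ0 ω w) hs0.le, wordR,
      ← Real.finsetProd_rpow _ _ (fun j _ => (hσ0.trans (ω _).1.2.1).le),
      ENNReal.ofReal_prod_of_nonneg]
    intro j _
    exact Real.rpow_nonneg (hσ0.trans (ω _).1.2.1).le _

lemma coord_law {d m : ℕ} {σm σp : ℝ} (θ : Measure (Od d)) (P : Measure (Omega d m σm σp))
    (hP2 : IsProductLaw θ P) (w : JW m) : P.map (fun ω => ω w) = labelM σm σp θ := by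
  ext A hA
  rw [Measure.map_apply (measurable_pi_apply w) hA]
  have := hP2 {w} (fun _ => A) (fun _ => hA)
  simp only [Finset.mem_singleton, forall_eq, Finset.prod_singleton] at this
  exact this

lemma coord_indep {d m : ℕ} {σm σp : ℝ} (θ : Measure (Od d)) (P : Measure (Omega d m σm σp))
    (hP2 : IsProductLaw θ P) : iIndepFun (fun (w : JW m) (ω : Omega d m σm σp) => ω w) P := by
  classical
  rw [iIndepFun_iff_measure_inter_preimage_eq_mul]
  intro S A hA
  let B : JW m → Set (Label d σm σp) := fun w => if w ∈ S then A w else Set.univ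
  have hB : ∀ w, MeasurableSet (B w) := by
    intro w
    by_cases h : w ∈ S
    · simpa [B, h] using hA w h
    · simp [B, h]
  have key := hP2 S B hB
  have e1 : {ω : Omega d m σm σp | ∀ w ∈ S, ω w ∈ B w} = ⋂ i ∈ S, (fun ω : Omega d m σm σp => ω i) ⁻¹' A i := by
    ext ω
    simp only [Set.mem_setOf_eq, Set.mem_iInter, Set.mem_preimage]
    refine forall₂_congr fun w hw => ?_
    simp [B, hw]
  rw [← e1, key]
  refine Finset.prod_congr rfl fun w hw => ?_
  rw [← coord_law θ P hP2 w, Measure.map_apply (measurable_pi_apply w) (hB w)]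
  simp [B, hw]

lemma label_int {d m : ℕ} (hm : 2 ≤ m) {σm σp : ℝ} (hσ0 : 0 < σm) (hσ1 : σm ≤ σp)
    (θ : Measure (Od d)) [IsProbabilityMeasure θ] (s : ℝ)
    (hs : ((m : ℝ) / (σp - σm)) * (∫ r in σm..σp, r ^ s) = 1) :
    ∫⁻ p : Label d σm σp, ENNReal.ofReal ((p.1 : ℝ) ^ s) ∂(labelM σm σp θ) = (m : ℝ≥0∞)⁻¹ := by
  have hlt : 0 < σp - σm := by
    rcases hσ1.eq_or_lt with h | h
    · rw [h] at hs; simp at hs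
    · linarith
  have hmeas : Measurable fun r : ↥(Set.Ioo σm σp) => ENNReal.ofReal ((r : ℝ) ^ s) := by fun_prop
  have h1 : ∫⁻ p : Label d σm σp, ENNReal.ofReal ((p.1 : ℝ) ^ s) ∂(labelM σm σp θ) =
      ∫⁻ r : ↥(Set.Ioo σm σp), ENNReal.ofReal ((r : ℝ) ^ s) ∂(unifSub σm σp) := by
    rw [labelM, lintegral_prod _ (by fun_prop)]
    simp
  have hint : IntervalIntegrable (fun r : ℝ => r ^ s) volume σm σp := by
    apply ContinuousOn.intervalIntegrable
    intro x hx
    rw [Set.uIcc_of_le hσ1] at hx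
    exact (Real.continuousAt_rpow_const x s (Or.inl (hσ0.trans_le hx.1).ne')).continuousWithinAt
  rw [h1, unifSub, lintegral_smul_measure, lintegral_subtype_comap measurableSet_Ioo
    (fun r : ℝ => ENNReal.ofReal (r ^ s)), ← ofReal_integral_eq_lintegral_ofReal]
  · rw [← integral_Ioc_eq_integral_Ioo, ← intervalIntegral.integral_of_le hσ1]
    have hm0 : (0 : ℝ) < m := by positivity
    have e : ∫ r in σm..σp, r ^ s = (σp - σm) * (m : ℝ)⁻¹ := by
      field_simp at hs ⊢
      linarith
    rw [e, ENNReal.ofReal_mul hlt.le, smul_eq_mul, ← mul_assoc, ENNReal.inv_mul_cancel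
      (by simpa using hlt) ENNReal.ofReal_ne_top, one_mul, ENNReal.ofReal_inv_of_pos hm0,
      ENNReal.ofReal_natCast]
  · exact ((intervalIntegrable_iff_integrableOn_Ioc_of_le hσ1).1 hint).mono_set Set.Ioo_subset_Ioc_self
  · refine (ae_restrict_iff' measurableSet_Ioo).2 (Eventually.of_forall fun x hx => ?_)
    exact Real.rpow_nonneg (hσ0.trans hx.1).le _

lemma word_int {d m : ℕ} (hm : 2 ≤ m) {σm σp : ℝ} (hσ0 : 0 < σm) (hσ1 : σm ≤ σp)
    (θ : Measure (Od d)) [IsProbabilityMeasure θ] (s : ℝ)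
    (hs : ((m : ℝ) / (σp - σm)) * (∫ r in σm..σp, r ^ s) = 1)
    (P : Measure (Omega d m σm σp)) (hP2 : IsProductLaw θ P) {n : ℕ} (w : Fin n → Fin m) :
    ∫⁻ ω, ∏ j : Fin n, ENNReal.ofReal (((ω ⟨j.1, fun t => w (Fin.castLE j.2 t)⟩).1 : ℝ) ^ s) ∂P
      = ((m : ℝ≥0∞)⁻¹) ^ n := by
  have hf : Measurable fun p : Label d σm σp => ENNReal.ofReal ((p.1 : ℝ) ^ s) := by fun_prop
  let g : Fin n → JW m := fun j => ⟨j.1, fun t => w (Fin.castLE j.2 t)⟩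
  have hg : Function.Injective g := by
    intro j k h
    exact Fin.ext (congrArg Sigma.fst h)
  have hind := ((coord_indep θ P hP2).precomp hg).comp
    (fun _ => fun p : Label d σm σp => ENNReal.ofReal ((p.1 : ℝ) ^ s)) (fun _ => hf)
  have := lintegral_prod_eq_prod_lintegral_of_indepFun Finset.univ _ hind
    (fun j => hf.comp (measurable_pi_apply (g j)))
  refine this.trans ?_
  rw [Finset.prod_congr rfl (g := fun _ => (m : ℝ≥0∞)⁻¹)]
  · simp
  · intro j _
    rw [← label_int hm hσ0 hσ1 θ s hs, ← coord_law θ P hP2 (g j),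
      lintegral_map hf (measurable_pi_apply (g j))]
    rfl


/-- For `ℙ`-almost every `ω`, `dim_H F(ω) ≤ min{s, d}`. -/
theorem stmt12 (d m : ℕ) (hd : 1 ≤ d) (hm : 2 ≤ m)
    (σm σp : ℝ) (hσ0 : 0 < σm) (hσ1 : σm ≤ σp) (hσ2 : σp < 1)
    (a : Fin m → E d) (ha : Function.Injective a)
    (θ : Measure (Od d)) (hθ1 : IsProbabilityMeasure θ) (hθ2 : θ.IsMulLeftInvariant)
    (P : Measure (Omega d m σm σp)) (hP1 : IsProbabilityMeasure P)
    (hP2 : IsProductLaw θ P)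
    (s : ℝ) (hs0 : 0 < s)
    (hs : ((m : ℝ) / (σp - σm)) * (∫ r in σm..σp, r ^ s) = 1) :
    ∀ᵐ ω ∂P, dimH (Fset a ω) ≤ min (ENNReal.ofReal s) (d : ℝ≥0∞) := by
  obtain ⟨C, hC, hdet⟩ := det_bound (d := d) (m := m) hσ0 hσ1 hσ2 a s hs0
  have hmeas : ∀ n : ℕ, Measurable fun ω : Omega d m σm σp => ∑ w : Fin n → Fin m,
      ENNReal.ofReal C ^ s * ∏ j : Fin n,
        ENNReal.ofReal (((ω ⟨j.1, fun t => w (Fin.castLE j.2 t)⟩).1 : ℝ) ^ s) := by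
    intro n
    fun_prop
  have hmT : (m : ℝ≥0∞) ≠ ⊤ := ENNReal.natCast_ne_top m
  have hm0 : (m : ℝ≥0∞) ≠ 0 := by
    have : m ≠ 0 := by omega
    exact_mod_cast this
  have hint : ∀ n : ℕ, ∫⁻ ω : Omega d m σm σp, ∑ w : Fin n → Fin m,
      ENNReal.ofReal C ^ s * ∏ j : Fin n,
        ENNReal.ofReal (((ω ⟨j.1, fun t => w (Fin.castLE j.2 t)⟩).1 : ℝ) ^ s) ∂P
        = ENNReal.ofReal C ^ s := by
    intro n
    rw [lintegral_finsetSum _ (fun w _ => by fun_prop)]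
    rw [Finset.sum_congr rfl (g := fun _ => ENNReal.ofReal C ^ s * ((m : ℝ≥0∞)⁻¹) ^ n)]
    · simp only [Finset.sum_const, Finset.card_univ, Fintype.card_fun, Fintype.card_fin,
        nsmul_eq_mul, Nat.cast_pow]
      rw [mul_left_comm, ← mul_pow, ENNReal.mul_inv_cancel hm0 hmT, one_pow, mul_one]
    · intro w _
      rw [lintegral_const_mul _ (by fun_prop), word_int hm hσ0 hσ1 θ s hs P hP2 w]
  have hfat := lintegral_liminf_le (μ := P) (u := atTop) hmeas
  simp only [hint, liminf_const] at hfat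
  have hfin : ENNReal.ofReal C ^ s ≠ ⊤ := ENNReal.rpow_ne_top_of_nonneg hs0.le ENNReal.ofReal_ne_top
  have hae := ae_lt_top (Measurable.liminf hmeas) (ne_top_of_le_ne_top hfin hfat)
  filter_upwards [hae] with ω hω
  refine le_min ?_ ?_
  · have h := ne_top_of_le_ne_top hω.ne (hdet ω)
    rw [← Real.coe_toNNReal s hs0.le] at h
    exact dimH_le_of_hausdorffMeasure_ne_top h
  · refine (dimH_mono (Set.subset_univ _)).trans ?_
    rw [Real.dimH_univ_eq_finrank]
    simp
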